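/- Let ℓ ≥ 2 and let ī, j̄ ∈ ℤ/ℓℤ. The Misra–Miwa operators on the v-deformed Fock space F_v satisfy the commutation relation E_ī F_j̄ − F_j̄ E_ī = δ_{ī,j̄} · (K_ī − K_ī⁻¹)/(v − v⁻¹) as ℚ(v)-linear endomorphisms of F_v, where δ_{ī,j̄} is 1 if ī = j̄ and 0 otherwise, and K_ī⁻¹ is the inverse of K_ī (given by K_ī⁻¹|λ⟩ = v^{−N_ī(λ)}|λ⟩). -/

import Mathlib

open scoped Classical

namespace MisraMiwa

/-- The content of a box `b = (i, j)` (row `i`, column `j`, indexed from 0): column minus row. -/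
def content (b : ℕ × ℕ) : ℤ := (b.2 : ℤ) - (b.1 : ℤ)

/-- The color of a box: its content modulo `ℓ`. -/
def color (ℓ : ℕ) (b : ℕ × ℕ) : ZMod ℓ := (content b : ZMod ℓ)

/-- `b` is an addable box of the partition (Young diagram) `μ`. -/
def IsAddable (μ : YoungDiagram) (b : ℕ × ℕ) : Prop :=
  b ∉ μ ∧ ∃ ν : YoungDiagram, (ν : Set (ℕ × ℕ)) = insert b (μ : Set (ℕ × ℕ))

/-- `b` is a removable box of the partition (Young diagram) `μ`. -/
def IsRemovable (μ : YoungDiagram) (b : ℕ × ℕ) : Prop :=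
  b ∈ μ ∧ ∃ ν : YoungDiagram, (ν : Set (ℕ × ℕ)) = (μ : Set (ℕ × ℕ)) \ {b}

/-- The partition obtained from `μ` by adding the addable box `b`. -/
noncomputable def added (μ : YoungDiagram) (b : ℕ × ℕ) : YoungDiagram :=
  if h : IsAddable μ b then h.2.choose else μ

/-- The partition obtained from `μ` by removing the removable box `b`. -/
noncomputable def erased (μ : YoungDiagram) (b : ℕ × ℕ) : YoungDiagram :=
  if h : IsRemovable μ b then h.2.choose else μ

/-- `A ℓ i μ` : the set of addable boxes of `μ` of color `i`. -/
def A (ℓ : ℕ) (i : ZMod ℓ) (μ : YoungDiagram) : Set (ℕ × ℕ) :=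
  {b | IsAddable μ b ∧ color ℓ b = i}

/-- `R ℓ i μ` : the set of removable boxes of `μ` of color `i`. -/
def R (ℓ : ℕ) (i : ZMod ℓ) (μ : YoungDiagram) : Set (ℕ × ℕ) :=
  {b | IsRemovable μ b ∧ color ℓ b = i}

/-- `Nc ℓ i μ = #A_i(μ) - #R_i(μ)`. -/
noncomputable def Nc (ℓ : ℕ) (i : ZMod ℓ) (μ : YoungDiagram) : ℤ :=
  ((A ℓ i μ).ncard : ℤ) - ((R ℓ i μ).ncard : ℤ)

/-- `b'` is to the left of `b` : its content is strictly larger. -/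
def LeftOf (b' b : ℕ × ℕ) : Prop := content b < content b'

/-- `b'` is to the right of `b` : its content is strictly smaller. -/
def RightOf (b' b : ℕ × ℕ) : Prop := content b' < content b

/-- `Nl ℓ i μ b` : number of removable boxes of `μ` of color `i` to the left of `b`
minus number of addable boxes of `μ` of color `i` to the left of `b`. -/
noncomputable def Nl (ℓ : ℕ) (i : ZMod ℓ) (μ : YoungDiagram) (b : ℕ × ℕ) : ℤ :=
  ({b' | b' ∈ R ℓ i μ ∧ LeftOf b' b}.ncard : ℤ) - ({b' | b' ∈ A ℓ i μ ∧ LeftOf b' b}.ncard : ℤ)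

/-- `Nr ℓ i μ b` : as `Nl`, but to the right of `b`. -/
noncomputable def Nr (ℓ : ℕ) (i : ZMod ℓ) (μ : YoungDiagram) (b : ℕ × ℕ) : ℤ :=
  ({b' | b' ∈ R ℓ i μ ∧ RightOf b' b}.ncard : ℤ) - ({b' | b' ∈ A ℓ i μ ∧ RightOf b' b}.ncard : ℤ)

/-- The `v`-deformed Fock space: the `ℚ(v)`-vector space with basis indexed by partitions. -/
abbrev Fock : Type := YoungDiagram →₀ RatFunc ℚ

/-- The indeterminate `v` of `ℚ(v)`. -/
noncomputable def v : RatFunc ℚ := RatFunc.X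

/-- `E_i |λ⟩ = Σ_μ v^(-N^r_i(λ/μ)) |μ⟩`, sum over `μ ⊂ λ` with `λ/μ` one box of color `i`. -/
noncomputable def Evec (ℓ : ℕ) (i : ZMod ℓ) (lam : YoungDiagram) : Fock :=
  ∑ᶠ b ∈ R ℓ i lam,
    v ^ (-Nr ℓ i (erased lam b) b) • Finsupp.single (erased lam b) (1 : RatFunc ℚ)

/-- `F_i |λ⟩ = Σ_μ v^(N^l_i(μ/λ)) |μ⟩`, sum over `μ ⊃ λ` with `μ/λ` one box of color `i`. -/
noncomputable def Fvec (ℓ : ℕ) (i : ZMod ℓ) (lam : YoungDiagram) : Fock :=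
  ∑ᶠ b ∈ A ℓ i lam,
    v ^ (Nl ℓ i lam b) • Finsupp.single (added lam b) (1 : RatFunc ℚ)

/-- The Misra–Miwa operator `E_i`. -/
noncomputable def Eop (ℓ : ℕ) (i : ZMod ℓ) : Fock →ₗ[RatFunc ℚ] Fock :=
  Finsupp.lsum (RatFunc ℚ) fun lam => LinearMap.toSpanSingleton (RatFunc ℚ) Fock (Evec ℓ i lam)

/-- The Misra–Miwa operator `F_i`. -/
noncomputable def Fop (ℓ : ℕ) (i : ZMod ℓ) : Fock →ₗ[RatFunc ℚ] Fock :=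
  Finsupp.lsum (RatFunc ℚ) fun lam => LinearMap.toSpanSingleton (RatFunc ℚ) Fock (Fvec ℓ i lam)

/-- The Misra–Miwa operator `K_i` : `K_i |λ⟩ = v^(N_i(λ)) |λ⟩`. -/
noncomputable def Kop (ℓ : ℕ) (i : ZMod ℓ) : Fock →ₗ[RatFunc ℚ] Fock :=
  Finsupp.lsum (RatFunc ℚ) fun lam =>
    LinearMap.toSpanSingleton (RatFunc ℚ) Fock (v ^ Nc ℓ i lam • Finsupp.single lam (1 : RatFunc ℚ))

/-- The inverse operator `K_i⁻¹ |λ⟩ = v^(-N_i(λ)) |λ⟩`. -/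
noncomputable def Kinvop (ℓ : ℕ) (i : ZMod ℓ) : Fock →ₗ[RatFunc ℚ] Fock :=
  Finsupp.lsum (RatFunc ℚ) fun lam =>
    LinearMap.toSpanSingleton (RatFunc ℚ) Fock
      (v ^ (-Nc ℓ i lam) • Finsupp.single lam (1 : RatFunc ℚ))

/-- The Cartan matrix entry of affine type `A^{(1)}_{ℓ-1}`. -/
noncomputable def cartan (ℓ : ℕ) (i j : ZMod ℓ) : ℤ :=
  2 * (if i = j then 1 else 0)
    - (({1, -1} : Finset ℤ).filter (fun e => j = i + (e : ZMod ℓ))).card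

/-- The `q`-integer `[n] = (q^n - q^{-n})/(q - q⁻¹)` in `ℚ(q)` (here `q = v`). -/
noncomputable def qint (n : ℤ) : RatFunc ℚ := (v ^ n - v ^ (-n)) / (v - v⁻¹)

/-- `hasVal p x n` : the nonzero rational function `x` has `p`-adic valuation `n`. -/
def hasVal (p : Polynomial ℚ) (x : RatFunc ℚ) (n : ℤ) : Prop :=
  ∃ a b : Polynomial ℚ, ¬ p ∣ a ∧ ¬ p ∣ b ∧
    x = algebraMap (Polynomial ℚ) (RatFunc ℚ) p ^ n *
        (algebraMap (Polynomial ℚ) (RatFunc ℚ) a / algebraMap (Polynomial ℚ) (RatFunc ℚ) b)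

/-- Addable boxes of `μ` in rows strictly above row `k` (rows indexed from 0). -/
def Alt (μ : YoungDiagram) (k : ℕ) : Set (ℕ × ℕ) := {b | IsAddable μ b ∧ b.1 < k}

/-- Removable boxes of `μ` in rows strictly above row `k` (rows indexed from 0). -/
def Rlt (μ : YoungDiagram) (k : ℕ) : Set (ℕ × ℕ) := {b | IsRemovable μ b ∧ b.1 < k}

/-- The degree-`n` component of Fock space: the span of `|λ⟩` for `|λ| = n`. -/
noncomputable def degComp (n : ℕ) : Submodule (RatFunc ℚ) Fock :=
  Submodule.span (RatFunc ℚ)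
    {f | ∃ lam : YoungDiagram, lam.card = n ∧ f = Finsupp.single lam (1 : RatFunc ℚ)}


/-! ### Combinatorics of addable and removable boxes -/

lemma isAddable_iff (μ : YoungDiagram) (i j : ℕ) :
    IsAddable μ (i, j) ↔ (i, j) ∉ μ ∧ (i = 0 ∨ (i - 1, j) ∈ μ) ∧ (j = 0 ∨ (i, j - 1) ∈ μ) := by
  constructor
  · rintro ⟨h, ν, hν⟩
    have hm : ∀ x, x ∈ ν ↔ x = (i, j) ∨ x ∈ μ := fun x => by
      have := Set.ext_iff.1 hν x
      simpa using this
    have hij : (i, j) ∈ ν := (hm _).2 (Or.inl rfl)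
    refine ⟨h, ?_, ?_⟩
    · rcases Nat.eq_zero_or_pos i with h0 | h0
      · exact Or.inl h0
      · right
        have := (hm _).1 (ν.up_left_mem (Nat.sub_le i 1) le_rfl hij)
        rcases this with h1 | h1
        · simp at h1; omega
        · exact h1
    · rcases Nat.eq_zero_or_pos j with h0 | h0
      · exact Or.inl h0
      · right
        have := (hm _).1 (ν.up_left_mem le_rfl (Nat.sub_le j 1) hij)
        rcases this with h1 | h1
        · simp at h1; omega
        · exact h1
  · rintro ⟨h, h1, h2⟩
    refine ⟨h, ⟨insert (i, j) μ.cells, ?_⟩, ?_⟩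
    · rintro ⟨a, b⟩ ⟨c, d⟩ hle hab
      simp only [Prod.mk_le_mk] at hle
      simp only [Finset.coe_insert, Set.mem_insert_iff, Finset.mem_coe, YoungDiagram.mem_cells,
        Prod.mk.injEq] at hab ⊢
      rcases hab with ⟨rfl, rfl⟩ | hab
      · by_cases hc : c = a
        · by_cases hd : d = b
          · exact Or.inl ⟨hc, hd⟩
          · right
            rcases h2 with h2 | h2
            · omega
            · exact μ.up_left_mem (by omega) (by omega) h2
        · right
          rcases h1 with h1 | h1
          · omega
          · exact μ.up_left_mem (by omega) (by omega) h1
      · exact Or.inr (μ.up_left_mem hle.1 hle.2 hab)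
    · ext x
      change x ∈ insert (i, j) μ.cells ↔ _
      simp

lemma isRemovable_iff (μ : YoungDiagram) (i j : ℕ) :
    IsRemovable μ (i, j) ↔ (i, j) ∈ μ ∧ (i + 1, j) ∉ μ ∧ (i, j + 1) ∉ μ := by
  constructor
  · rintro ⟨h, ν, hν⟩
    have hm : ∀ x, x ∈ ν ↔ x ∈ μ ∧ x ≠ (i, j) := fun x => by
      have := Set.ext_iff.1 hν x
      simpa using this
    have hij : (i, j) ∉ ν := fun h' => ((hm _).1 h').2 rfl
    refine ⟨h, fun h1 => hij ?_, fun h1 => hij ?_⟩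
    · exact ν.up_left_mem (Nat.le_succ i) le_rfl ((hm _).2 ⟨h1, by simp⟩)
    · exact ν.up_left_mem le_rfl (Nat.le_succ j) ((hm _).2 ⟨h1, by simp⟩)
  · rintro ⟨h, h1, h2⟩
    refine ⟨h, ⟨μ.cells.erase (i, j), ?_⟩, ?_⟩
    · rintro ⟨a, b⟩ ⟨c, d⟩ hle hab
      simp only [Prod.mk_le_mk] at hle
      simp only [Finset.coe_erase, Set.mem_sdiff, Set.mem_singleton_iff, Finset.mem_coe,
        YoungDiagram.mem_cells, Prod.mk.injEq] at hab ⊢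
      refine ⟨μ.up_left_mem hle.1 hle.2 hab.1, ?_⟩
      rintro ⟨rfl, rfl⟩
      by_cases hc : a = c
      · exact h2 (μ.up_left_mem (by omega) (by omega) hab.1)
      · exact h1 (μ.up_left_mem (by omega) (by omega) hab.1)
    · ext x
      change x ∈ μ.cells.erase (i, j) ↔ _
      simp [and_comm]

lemma mem_added {μ : YoungDiagram} {b : ℕ × ℕ} (h : IsAddable μ b) (x : ℕ × ℕ) :
    x ∈ added μ b ↔ x = b ∨ x ∈ μ := by
  have := Set.ext_iff.1 h.2.choose_spec x
  rw [added, dif_pos h]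
  simpa using this

lemma mem_erased {μ : YoungDiagram} {b : ℕ × ℕ} (h : IsRemovable μ b) (x : ℕ × ℕ) :
    x ∈ erased μ b ↔ x ∈ μ ∧ x ≠ b := by
  have := Set.ext_iff.1 h.2.choose_spec x
  rw [erased, dif_pos h]
  simpa using this

lemma removable_added {μ : YoungDiagram} {b : ℕ × ℕ} (h : IsAddable μ b) :
    IsRemovable (added μ b) b := by
  refine ⟨(mem_added h b).2 (Or.inl rfl), μ, ?_⟩
  ext x
  have h0 := h.1
  have := mem_added h x
  simp only [SetLike.mem_coe, Set.mem_sdiff, Set.mem_singleton_iff, this]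
  constructor
  · intro hx
    exact ⟨Or.inr hx, fun hxb => h0 (hxb ▸ hx)⟩
  · tauto

lemma addable_erased {μ : YoungDiagram} {b : ℕ × ℕ} (h : IsRemovable μ b) :
    IsAddable (erased μ b) b := by
  refine ⟨fun hb => ((mem_erased h b).1 hb).2 rfl, μ, ?_⟩
  ext x
  have h0 := h.1
  have := mem_erased h x
  simp only [SetLike.mem_coe, Set.mem_insert_iff, this]
  constructor
  · tauto
  · rintro (rfl | hx)
    · exact h0
    · exact hx.1

lemma erased_added {μ : YoungDiagram} {b : ℕ × ℕ} (h : IsAddable μ b) :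
    erased (added μ b) b = μ := by
  apply SetLike.ext
  intro x
  rw [mem_erased (removable_added h), mem_added h]
  have h0 := h.1
  constructor
  · tauto
  · intro hx
    exact ⟨Or.inr hx, fun hxb => h0 (hxb ▸ hx)⟩

lemma added_erased {μ : YoungDiagram} {b : ℕ × ℕ} (h : IsRemovable μ b) :
    added (erased μ b) b = μ := by
  apply SetLike.ext
  intro x
  rw [mem_added (addable_erased h), mem_erased h]
  have h0 := h.1
  constructor
  · rintro (rfl | hx)
    · exact h0
    · exact hx.1
  · tauto

lemma swap_iff (μ : YoungDiagram) (b b' : ℕ × ℕ) (hne : b' ≠ b) :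
    (IsAddable μ b ∧ IsRemovable (added μ b) b') ↔
      (IsRemovable μ b' ∧ IsAddable (erased μ b') b) := by
  constructor
  · rintro ⟨h, h'⟩
    have hb' : b' ∈ μ := ((mem_added h b').1 h'.1).resolve_left hne
    have hr : IsRemovable μ b' := by
      refine ⟨hb', erased (added μ b) b' ⊓ μ, ?_⟩
      ext x
      have h1 := mem_erased h' x
      have h2 := mem_added h x
      have h3 : x ∈ erased (added μ b) b' ⊓ μ ↔ x ∈ erased (added μ b) b' ∧ x ∈ μ :=
        YoungDiagram.mem_inf
      simp only [SetLike.mem_coe, Set.mem_sdiff, Set.mem_singleton_iff, h3, h1, h2]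
      tauto
    refine ⟨hr, fun hb => h.1 ((mem_erased hr b).1 hb).1, erased (added μ b) b', ?_⟩
    ext x
    simp only [SetLike.mem_coe, Set.mem_insert_iff, mem_erased h', mem_added h, mem_erased hr]
    constructor
    · tauto
    · rintro (rfl | hx)
      · exact ⟨Or.inl rfl, hne.symm⟩
      · tauto
  · rintro ⟨h, h'⟩
    have hb : b ∉ μ := fun hb => h'.1 ((mem_erased h b).2 ⟨hb, hne.symm⟩)
    have ha : IsAddable μ b := by
      refine ⟨hb, added (erased μ b') b ⊔ μ, ?_⟩
      ext x
      have h3 : x ∈ added (erased μ b') b ⊔ μ ↔ x ∈ added (erased μ b') b ∨ x ∈ μ :=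
        YoungDiagram.mem_sup
      simp only [SetLike.mem_coe, Set.mem_insert_iff, h3, mem_added h', mem_erased h]
      tauto
    refine ⟨ha, (mem_added ha b').2 (Or.inr h.1), added (erased μ b') b, ?_⟩
    ext x
    simp only [SetLike.mem_coe, Set.mem_sdiff, Set.mem_singleton_iff, mem_added h', mem_erased h,
      mem_added ha]
    constructor
    · rintro (rfl | hx)
      · exact ⟨Or.inl rfl, hne.symm⟩
      · tauto
    · tauto

lemma swap_eq {μ : YoungDiagram} {b b' : ℕ × ℕ} (hne : b' ≠ b)
    (h : IsAddable μ b) (h' : IsRemovable (added μ b) b') :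
    erased (added μ b) b' = added (erased μ b') b := by
  obtain ⟨hr, ha⟩ := (swap_iff μ b b' hne).1 ⟨h, h'⟩
  apply SetLike.ext
  intro x
  rw [mem_erased h', mem_added h, mem_added ha, mem_erased hr]
  constructor
  · tauto
  · rintro (rfl | hx)
    · exact ⟨Or.inl rfl, hne.symm⟩
    · tauto

lemma finite_addable (μ : YoungDiagram) : {b | IsAddable μ b}.Finite := by
  refine Set.Finite.subset (((μ.cells.image fun x => (x.1 + 1, x.2)) ∪
    (μ.cells.image fun x => (x.1, x.2 + 1)) ∪ {(0, 0)} : Finset (ℕ × ℕ)).finite_toSet) ?_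
  rintro ⟨i, j⟩ h
  obtain ⟨_, h1, h2⟩ := (isAddable_iff μ i j).1 h
  simp only [Finset.coe_union, Finset.coe_image, Set.mem_union, Set.mem_image, Finset.mem_coe,
    Finset.mem_singleton, YoungDiagram.mem_cells]
  rcases Nat.eq_zero_or_pos i with hi | hi
  · rcases Nat.eq_zero_or_pos j with hj | hj
    · right; simp [hi, hj]
    · left; right
      exact ⟨(i, j - 1), h2.resolve_left (by omega), by ext <;> simp; omega⟩
  · left; left
    exact ⟨(i - 1, j), h1.resolve_left (by omega), by ext <;> simp; omega⟩

lemma finite_removable (μ : YoungDiagram) : {b | IsRemovable μ b}.Finite :=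
  μ.cells.finite_toSet.subset fun _ h => h.1

lemma content_injOn_addable (μ : YoungDiagram) : Set.InjOn content {b | IsAddable μ b} := by
  rintro ⟨i, j⟩ h ⟨i', j'⟩ h' he
  obtain ⟨h0, h1, h2⟩ := (isAddable_iff μ i j).1 h
  obtain ⟨h0', h1', h2'⟩ := (isAddable_iff μ i' j').1 h'
  simp only [content] at he
  rcases lt_trichotomy i i' with hlt | heq | hlt
  · exact absurd (μ.up_left_mem (by omega) (by omega) (h1'.resolve_left (by omega))) h0
  · ext
    · exact heq
    · simp; omega
  · exact absurd (μ.up_left_mem (by omega) (by omega) (h1.resolve_left (by omega))) h0'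

lemma content_injOn_removable (μ : YoungDiagram) : Set.InjOn content {b | IsRemovable μ b} := by
  rintro ⟨i, j⟩ h ⟨i', j'⟩ h' he
  obtain ⟨h0, h1, h2⟩ := (isRemovable_iff μ i j).1 h
  obtain ⟨h0', h1', h2'⟩ := (isRemovable_iff μ i' j').1 h'
  simp only [content] at he
  rcases lt_trichotomy i i' with hlt | heq | hlt
  · exact absurd (μ.up_left_mem (by omega) (by omega) h0') h1
  · ext
    · exact heq
    · simp; omega
  · exact (h1' (μ.up_left_mem (by omega) (by omega) h0)).elim

/-- Number of boxes of content `c`. -/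
noncomputable def dcount (μ : YoungDiagram) (c : ℤ) : ℕ :=
  (μ.cells.filter (fun b => content b = c)).card

lemma dcount_added {μ : YoungDiagram} {b : ℕ × ℕ} (h : IsAddable μ b) (c : ℤ) :
    dcount (added μ b) c = dcount μ c + if c = content b then 1 else 0 := by
  have hc : (added μ b).cells = insert b μ.cells := by
    ext x
    simp [mem_added h]
  have hb : b ∉ μ.cells := h.1
  rw [dcount, dcount, hc, Finset.filter_insert]
  by_cases hcb : content b = c
  · rw [if_pos hcb, if_pos hcb.symm, Finset.card_insert_of_notMem]
    simp [h.1]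
  · rw [if_neg hcb, if_neg (Ne.symm hcb), add_zero]

lemma mem_iff_dcount (μ : YoungDiagram) (i j : ℕ) :
    (i, j) ∈ μ ↔ min i j < dcount μ ((j : ℤ) - i) := by
  set c : ℤ := (j : ℤ) - i with hc
  set f : ℕ → ℕ × ℕ := fun k => (k + (-c).toNat, k + c.toNat) with hf
  have hinj : Function.Injective f := fun a b hab => by
    simp only [hf, Prod.mk.injEq] at hab
    omega
  have hex : ∃ k, f k ∉ μ := by
    by_contra hcon
    push Not at hcon
    exact Set.infinite_of_injective_forall_mem hinj (s := (μ.cells : Set (ℕ × ℕ)))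
      (fun k => hcon k) μ.cells.finite_toSet
  have hfind : ∀ k, f k ∈ μ ↔ k < Nat.find hex := by
    intro k
    rw [Nat.lt_find_iff]
    constructor
    · intro hk m hm hn
      exact hn (μ.up_left_mem (by omega) (by omega) hk)
    · intro hk
      have := hk k le_rfl
      simpa using this
  have hcard : dcount μ c = Nat.find hex := by
    have : μ.cells.filter (fun b => content b = c) = (Finset.range (Nat.find hex)).image f := by
      ext ⟨a, b⟩
      rw [Finset.mem_filter, YoungDiagram.mem_cells, Finset.mem_image]
      simp only [content, Finset.mem_range]
      constructor
      · rintro ⟨h1, h2⟩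
        have hfe : f (min a b) = (a, b) := by
          simp only [hf, Prod.mk.injEq]
          omega
        refine ⟨min a b, ?_, hfe⟩
        rw [← hfind, hfe]
        exact h1
      · rintro ⟨k, hk, hk2⟩
        rw [← hfind, hk2] at hk
        refine ⟨hk, ?_⟩
        simp only [hf, Prod.mk.injEq] at hk2
        omega
    rw [dcount, this, Finset.card_image_of_injective _ hinj, Finset.card_range]
  have hfe : f (min i j) = (i, j) := by
    simp only [hf, Prod.mk.injEq]
    omega
  rw [hcard, ← hfind, hfe]

/-- Signed number of removable minus addable boxes of content `c`. -/
noncomputable def Dc (μ : YoungDiagram) (c : ℤ) : ℤ :=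
  (if ∃ b, IsRemovable μ b ∧ content b = c then 1 else 0) -
    (if ∃ b, IsAddable μ b ∧ content b = c then 1 else 0)

lemma exists_removable_iff (μ : YoungDiagram) (c : ℤ) :
    (∃ b, IsRemovable μ b ∧ content b = c) ↔
      0 < dcount μ c ∧ dcount μ (c + 1) < dcount μ c + (if c < 0 then 1 else 0) ∧
        dcount μ (c - 1) < dcount μ c + (if 0 < c then 1 else 0) := by
  constructor
  · rintro ⟨⟨i, j⟩, h, hc⟩
    change (j : ℤ) - i = c at hc
    subst hc
    rw [isRemovable_iff] at h
    obtain ⟨h0, h1, h2⟩ := h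
    rw [mem_iff_dcount] at h0 h1 h2
    have e1 : ((j : ℤ) - ((i + 1 : ℕ) : ℤ)) = (j : ℤ) - i - 1 := by push_cast; ring
    have e2 : (((j + 1 : ℕ) : ℤ) - (i : ℤ)) = (j : ℤ) - i + 1 := by push_cast; ring
    rw [e1] at h1
    rw [e2] at h2
    -- the box is the last one on its diagonal
    have h3 : (i + 1, j + 1) ∉ μ := fun h3 => by
      have := μ.up_left_mem (le_refl (i + 1)) (Nat.le_succ j) h3
      rw [mem_iff_dcount, e1] at this
      exact h1 this
    rw [mem_iff_dcount] at h3
    have e3 : (((j + 1 : ℕ) : ℤ) - ((i + 1 : ℕ) : ℤ)) = (j : ℤ) - i := by push_cast; ring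
    rw [e3] at h3
    refine ⟨by omega, ?_, ?_⟩ <;> split_ifs <;> omega
  · rintro ⟨h0, h1, h2⟩
    refine ⟨(dcount μ c - 1 + (-c).toNat, dcount μ c - 1 + c.toNat), ?_, ?_⟩
    · rw [isRemovable_iff, mem_iff_dcount, mem_iff_dcount, mem_iff_dcount]
      have e0 : (((dcount μ c - 1 + c.toNat : ℕ) : ℤ) - ((dcount μ c - 1 + (-c).toNat : ℕ) : ℤ))
          = c := by omega
      have e1 : (((dcount μ c - 1 + c.toNat : ℕ) : ℤ)
          - ((dcount μ c - 1 + (-c).toNat + 1 : ℕ) : ℤ)) = c - 1 := by omega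
      have e2 : (((dcount μ c - 1 + c.toNat + 1 : ℕ) : ℤ)
          - ((dcount μ c - 1 + (-c).toNat : ℕ) : ℤ)) = c + 1 := by omega
      rw [e0, e1, e2]
      split_ifs at h1 h2 <;> omega
    · simp only [content]
      omega

lemma exists_addable_iff (μ : YoungDiagram) (c : ℤ) :
    (∃ b, IsAddable μ b ∧ content b = c) ↔
      dcount μ c + (if c < 0 then 1 else 0) ≤ dcount μ (c + 1) ∧
        dcount μ c + (if 0 < c then 1 else 0) ≤ dcount μ (c - 1) := by
  constructor
  · rintro ⟨⟨i, j⟩, h, hc⟩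
    change (j : ℤ) - i = c at hc
    subst hc
    rw [isAddable_iff] at h
    obtain ⟨h0, h1, h2⟩ := h
    have h3 : i = 0 ∨ j = 0 ∨ (i - 1, j - 1) ∈ μ := by
      rcases h1 with h1 | h1
      · exact Or.inl h1
      · exact Or.inr (Or.inr (μ.up_left_mem le_rfl (Nat.sub_le j 1) h1))
    rw [mem_iff_dcount] at h0 h1 h2 h3
    have hd : dcount μ ((j : ℤ) - i) = min i j := by
      by_cases hi : i = 0
      · omega
      · by_cases hj : j = 0
        · omega
        · have e3 : (((j - 1 : ℕ) : ℤ) - ((i - 1 : ℕ) : ℤ)) = (j : ℤ) - i := by omega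
          rw [e3] at h3
          omega
    rw [hd]
    constructor
    · by_cases hi : i = 0
      · split_ifs <;> omega
      · have e1 : ((j : ℤ) - ((i - 1 : ℕ) : ℤ)) = (j : ℤ) - i + 1 := by omega
        rw [e1] at h1
        split_ifs <;> omega
    · by_cases hj : j = 0
      · split_ifs <;> omega
      · have e2 : (((j - 1 : ℕ) : ℤ) - (i : ℤ)) = (j : ℤ) - i - 1 := by omega
        rw [e2] at h2
        split_ifs <;> omega
  · rintro ⟨h1, h2⟩
    refine ⟨(dcount μ c + (-c).toNat, dcount μ c + c.toNat), ?_, ?_⟩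
    · rw [isAddable_iff, mem_iff_dcount, mem_iff_dcount, mem_iff_dcount]
      have e0 : (((dcount μ c + c.toNat : ℕ) : ℤ) - ((dcount μ c + (-c).toNat : ℕ) : ℤ))
          = c := by omega
      rw [e0]
      refine ⟨by omega, ?_, ?_⟩
      · by_cases hz : dcount μ c + (-c).toNat = 0
        · exact Or.inl hz
        · right
          have e1 : (((dcount μ c + c.toNat : ℕ) : ℤ)
            - ((dcount μ c + (-c).toNat - 1 : ℕ) : ℤ)) = c + 1 := by omega
          rw [e1]
          split_ifs at h1 h2 <;> omega
      · by_cases hz : dcount μ c + c.toNat = 0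
        · exact Or.inl hz
        · right
          have e1 : (((dcount μ c + c.toNat - 1 : ℕ) : ℤ)
            - ((dcount μ c + (-c).toNat : ℕ) : ℤ)) = c - 1 := by omega
          rw [e1]
          split_ifs at h1 h2 <;> omega
    · simp only [content]
      omega

lemma mem_of_dcount (μ : YoungDiagram) (c : ℤ) (k : ℕ) :
    (k + (-c).toNat, k + c.toNat) ∈ μ ↔ k < dcount μ c := by
  rw [mem_iff_dcount]
  have e0 : (((k + c.toNat : ℕ) : ℤ) - ((k + (-c).toNat : ℕ) : ℤ)) = c := by omega
  have e1 : min (k + (-c).toNat) (k + c.toNat) = k := by omega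
  rw [e0, e1]

lemma dcount_step_right (μ : YoungDiagram) (c : ℤ) (hc : 0 ≤ c) :
    dcount μ (c + 1) ≤ dcount μ c ∧ dcount μ c ≤ dcount μ (c + 1) + 1 := by
  constructor
  · by_contra hlt
    push Not at hlt
    have h1 := (mem_of_dcount μ (c + 1) (dcount μ c)).2 hlt
    have h2 := μ.up_left_mem (i1 := dcount μ c + (-c).toNat) (j1 := dcount μ c + c.toNat)
      (by omega) (by omega) h1
    rw [mem_of_dcount] at h2
    omega
  · by_contra hlt
    push Not at hlt
    have h1 := (mem_of_dcount μ c (dcount μ (c + 1) + 1)).2 hlt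
    have h2 := μ.up_left_mem (i1 := dcount μ (c + 1) + (-(c + 1)).toNat)
      (j1 := dcount μ (c + 1) + (c + 1).toNat) (by omega) (by omega) h1
    rw [mem_of_dcount] at h2
    omega

lemma dcount_step_left (μ : YoungDiagram) (c : ℤ) (hc : c ≤ 0) :
    dcount μ (c - 1) ≤ dcount μ c ∧ dcount μ c ≤ dcount μ (c - 1) + 1 := by
  constructor
  · by_contra hlt
    push Not at hlt
    have h1 := (mem_of_dcount μ (c - 1) (dcount μ c)).2 hlt
    have h2 := μ.up_left_mem (i1 := dcount μ c + (-c).toNat) (j1 := dcount μ c + c.toNat)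
      (by omega) (by omega) h1
    rw [mem_of_dcount] at h2
    omega
  · by_contra hlt
    push Not at hlt
    have h1 := (mem_of_dcount μ c (dcount μ (c - 1) + 1)).2 hlt
    have h2 := μ.up_left_mem (i1 := dcount μ (c - 1) + (-(c - 1)).toNat)
      (j1 := dcount μ (c - 1) + (c - 1).toNat) (by omega) (by omega) h1
    rw [mem_of_dcount] at h2
    omega

/-- The signed count is a second difference of the diagonal lengths. -/
lemma Dc_eq (μ : YoungDiagram) (c : ℤ) :
    Dc μ c = 2 * dcount μ c - dcount μ (c + 1) - dcount μ (c - 1) - if c = 0 then 1 else 0 := by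
  rw [Dc, if_congr (exists_removable_iff μ c) rfl rfl, if_congr (exists_addable_iff μ c) rfl rfl]
  rcases lt_trichotomy c 0 with hc | hc | hc
  · have h1 := dcount_step_left μ c hc.le
    have h2 := dcount_step_left μ (c + 1) (by omega)
    rw [add_sub_cancel_right] at h2
    have n1 : ¬ 0 < c := by omega
    have n2 : ¬ c = 0 := by omega
    simp only [hc, n1, n2, if_true, if_false]
    split_ifs <;> omega
  · subst hc
    have h1 := dcount_step_left μ 0 le_rfl
    have h2 := dcount_step_right μ 0 le_rfl
    simp only [lt_irrefl, if_true, if_false]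
    split_ifs <;> omega
  · have h1 := dcount_step_right μ c hc.le
    have h2 := dcount_step_right μ (c - 1) (by omega)
    rw [sub_add_cancel] at h2
    have n1 : ¬ c < 0 := by omega
    have n2 : ¬ c = 0 := by omega
    simp only [hc, n1, n2, if_true, if_false]
    split_ifs <;> omega

/-- The change of `Dc` when a box is added. -/
def gfun (x : ℤ) : ℤ := if x = 0 then 2 else if x = 1 then -1 else if x = -1 then -1 else 0

lemma gfun_neg (x : ℤ) : gfun (-x) = gfun x := by
  unfold gfun
  split_ifs <;> omega

lemma Dc_added {μ : YoungDiagram} {b : ℕ × ℕ} (h : IsAddable μ b) (c : ℤ) :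
    Dc (added μ b) c - Dc μ c = gfun (c - content b) := by
  rw [Dc_eq, Dc_eq, dcount_added h, dcount_added h, dcount_added h]
  unfold gfun
  push_cast
  split_ifs <;> omega

lemma Dc_support_finite (μ : YoungDiagram) : (Function.support (Dc μ)).Finite := by
  refine (((finite_addable μ).image content).union ((finite_removable μ).image content)).subset ?_
  intro c hc
  by_contra hcon
  apply hc
  simp only [Set.mem_union, Set.mem_image, Set.mem_ofPred_eq, not_or] at hcon
  rw [Dc, if_neg hcon.1, if_neg hcon.2, sub_zero]

/-- Sum of `Dc` over the contents satisfying `P`. -/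
noncomputable def Dsum (μ : YoungDiagram) (P : ℤ → Prop) : ℤ := ∑ᶠ c, if P c then Dc μ c else 0

lemma ncard_eq_finsum {S : Set (ℕ × ℕ)} (hS : S.Finite) (hinj : Set.InjOn content S) :
    (S.ncard : ℤ) = ∑ᶠ c : ℤ, if ∃ b ∈ S, content b = c then (1 : ℤ) else 0 := by
  have h1 : (Function.support fun c : ℤ => if ∃ b ∈ S, content b = c then (1 : ℤ) else 0) ⊆
      ((hS.image content).toFinset : Set ℤ) := by
    intro c hc
    simp only [Set.Finite.coe_toFinset, Set.mem_image]
    by_contra hcon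
    exact hc (if_neg hcon)
  rw [finsum_eq_sum_of_support_subset _ h1, ← hinj.ncard_image,
    Set.ncard_eq_toFinset_card _ (hS.image content), Finset.card_eq_sum_ones, Nat.cast_sum]
  refine Finset.sum_congr rfl fun c hc => ?_
  have : ∃ b ∈ S, content b = c := by simpa using hc
  rw [if_pos this]
  simp

lemma ncard_sub_eq (μ : YoungDiagram) (P : ℤ → Prop) :
    (({b | IsRemovable μ b ∧ P (content b)}.ncard : ℤ)
      - ({b | IsAddable μ b ∧ P (content b)}.ncard : ℤ)) = Dsum μ P := by
  have hfR : {b | IsRemovable μ b ∧ P (content b)}.Finite :=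
    (finite_removable μ).subset fun _ h => h.1
  have hfA : {b | IsAddable μ b ∧ P (content b)}.Finite :=
    (finite_addable μ).subset fun _ h => h.1
  rw [ncard_eq_finsum hfR ((content_injOn_removable μ).mono fun _ h => h.1),
    ncard_eq_finsum hfA ((content_injOn_addable μ).mono fun _ h => h.1), ← finsum_sub_distrib]
  · unfold Dsum
    apply finsum_congr
    intro c
    have key : ∀ Q : ℕ × ℕ → Prop, (∃ b ∈ {b | Q b ∧ P (content b)}, content b = c) ↔
        P c ∧ ∃ b, Q b ∧ content b = c := by
      intro Q
      constructor
      · rintro ⟨b, ⟨h1, h2⟩, rfl⟩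
        exact ⟨h2, b, h1, rfl⟩
      · rintro ⟨h2, b, h1, rfl⟩
        exact ⟨b, ⟨h1, h2⟩, rfl⟩
    rw [if_congr (key _) rfl rfl, if_congr (key _) rfl rfl]
    by_cases hP : P c
    · simp only [hP, true_and, if_true, Dc]
    · simp only [hP, false_and, if_false, sub_zero]
  · refine (hfR.image content).subset fun c hc => ?_
    by_contra hcon
    exact hc (if_neg hcon)
  · refine (hfA.image content).subset fun c hc => ?_
    by_contra hcon
    exact hc (if_neg hcon)

lemma Nl_eq (ℓ : ℕ) (i : ZMod ℓ) (μ : YoungDiagram) (b : ℕ × ℕ) :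
    Nl ℓ i μ b = Dsum μ (fun c => (c : ZMod ℓ) = i ∧ content b < c) := by
  rw [← ncard_sub_eq, Nl]
  simp only [A, R, LeftOf, color, Set.mem_ofPred_eq, and_assoc]

lemma Nr_eq (ℓ : ℕ) (i : ZMod ℓ) (μ : YoungDiagram) (b : ℕ × ℕ) :
    Nr ℓ i μ b = Dsum μ (fun c => (c : ZMod ℓ) = i ∧ c < content b) := by
  rw [← ncard_sub_eq, Nr]
  simp only [A, R, RightOf, color, Set.mem_ofPred_eq, and_assoc]

lemma Nc_eq (ℓ : ℕ) (i : ZMod ℓ) (μ : YoungDiagram) :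
    Nc ℓ i μ = - Dsum μ (fun c => (c : ZMod ℓ) = i) := by
  rw [← ncard_sub_eq, Nc]
  simp only [A, R, color]
  ring

lemma ite_Dc_finite (μ : YoungDiagram) (P : ℤ → Prop) :
    (Function.support fun c => if P c then Dc μ c else 0).Finite := by
  refine (Dc_support_finite μ).subset fun c hc => ?_
  simp only [Function.mem_support] at hc ⊢
  intro h0
  simp [h0] at hc

lemma Dsum_added {μ : YoungDiagram} {b : ℕ × ℕ} (h : IsAddable μ b) (P : ℤ → Prop) :
    Dsum (added μ b) P - Dsum μ P = ∑ᶠ c, if P c then gfun (c - content b) else 0 := by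
  unfold Dsum
  rw [← finsum_sub_distrib (ite_Dc_finite _ _) (ite_Dc_finite _ _)]
  apply finsum_congr
  intro c
  rw [← Dc_added h]
  split_ifs <;> simp

/-- Adding a box does not change `Dsum` away from its neighbourhood. -/
lemma Dsum_added_far {μ : YoungDiagram} {b : ℕ × ℕ} (h : IsAddable μ b) (P : ℤ → Prop)
    (hP : ∀ c, P c → gfun (c - content b) = 0) : Dsum (added μ b) P = Dsum μ P := by
  have h1 := Dsum_added h P
  have h2 : (∑ᶠ c, if P c then gfun (c - content b) else 0) = 0 := by
    apply finsum_eq_zero_of_forall_eq_zero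
    intro c
    split_ifs with hc
    · exact hP c hc
    · rfl
  omega

lemma gfun_same_color {ℓ : ℕ} (hℓ : 2 ≤ ℓ) {c d : ℤ} (h : (c : ZMod ℓ) = d) (hne : c ≠ d) :
    gfun (c - d) = 0 := by
  have h1 : (ℓ : ℤ) ∣ c - d := by
    rw [← ZMod.intCast_zmod_eq_zero_iff_dvd]
    · push_cast
      rw [h, sub_self]
  have h2 : (ℓ : ℤ) ≤ |c - d| := Int.le_of_dvd (abs_pos.2 (sub_ne_zero.2 hne)) ((dvd_abs _ _).2 h1)
  have h3 : (2 : ℤ) ≤ |c - d| := le_trans (by exact_mod_cast hℓ) h2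
  rw [le_abs] at h3
  unfold gfun
  split_ifs <;> omega

lemma Nl_added_self {ℓ : ℕ} (hℓ : 2 ≤ ℓ) {μ : YoungDiagram} {b : ℕ × ℕ} (h : IsAddable μ b) :
    Nl ℓ (color ℓ b) (added μ b) b = Nl ℓ (color ℓ b) μ b := by
  rw [Nl_eq, Nl_eq]
  exact Dsum_added_far h _ fun c hc => gfun_same_color hℓ hc.1 hc.2.ne'

lemma Nr_added_self {ℓ : ℕ} (hℓ : 2 ≤ ℓ) {μ : YoungDiagram} {b : ℕ × ℕ} (h : IsAddable μ b) :
    Nr ℓ (color ℓ b) (added μ b) b = Nr ℓ (color ℓ b) μ b := by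
  rw [Nr_eq, Nr_eq]
  exact Dsum_added_far h _ fun c hc => gfun_same_color hℓ hc.1 hc.2.ne

/-- The exponents of the two off-diagonal terms agree. -/
lemma exponent_swap (ℓ : ℕ) {μ : YoungDiagram} {b b' : ℕ × ℕ}
    (hb : IsAddable μ b) (hb' : IsAddable μ b') :
    Nl ℓ (color ℓ b) (added μ b') b - Nl ℓ (color ℓ b) μ b =
      Nr ℓ (color ℓ b') (added μ b) b' - Nr ℓ (color ℓ b') μ b' := by
  rw [Nl_eq, Nl_eq, Nr_eq, Nr_eq, Dsum_added hb, Dsum_added hb',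
    ← finsum_comp_equiv (Equiv.subLeft (content b + content b'))]
  apply finsum_congr
  intro c
  simp only [Equiv.subLeft_apply]
  have e : content b + content b' - c - content b' = -(c - content b) := by ring
  rw [e, gfun_neg]
  have e2 : (((content b + content b' - c : ℤ) : ZMod ℓ) = color ℓ b ∧
      content b < content b + content b' - c) ↔
      ((c : ZMod ℓ) = color ℓ b' ∧ c < content b') := by
    unfold color
    push_cast
    constructor
    · rintro ⟨h, h2⟩
      exact ⟨by linear_combination -h, by omega⟩
    · rintro ⟨h, h2⟩
      exact ⟨by linear_combination -h, by omega⟩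
  by_cases hc : (c : ZMod ℓ) = color ℓ b' ∧ c < content b'
  · rw [if_pos hc, if_pos (e2.2 hc)]
  · rw [if_neg hc, if_neg (fun h => hc (e2.1 h))]

/-! ### Algebra -/

lemma v_ne_zero : v ≠ 0 := RatFunc.X_ne_zero

lemma v_sub_ne_zero : v - v⁻¹ ≠ 0 := by
  intro h
  have h1 : v * v = 1 := by
    have h2 : v = v⁻¹ := sub_eq_zero.1 h
    calc v * v = v * v⁻¹ := by rw [← h2]
      _ = 1 := mul_inv_cancel₀ v_ne_zero
  have h3 : (algebraMap (Polynomial ℚ) (RatFunc ℚ)) (Polynomial.X * Polynomial.X) =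
      (algebraMap (Polynomial ℚ) (RatFunc ℚ)) 1 := by
    rw [map_mul, RatFunc.algebraMap_X, map_one]
    exact h1
  have h4 := RatFunc.algebraMap_injective ℚ h3
  have h5 := congrArg (Polynomial.eval 0) h4
  simp at h5

lemma telescope (s : ℤ → ℤ) (hs : ∀ c, s c = -1 ∨ s c = 0 ∨ s c = 1) (S : Finset ℤ) :
    (∑ c ∈ S, (s c : RatFunc ℚ) *
      v ^ ((∑ d ∈ S with d < c, s d) - ∑ d ∈ S with c < d, s d)) * (v - v⁻¹) =
      v ^ (∑ c ∈ S, s c) - v ^ (-∑ c ∈ S, s c) := by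
  induction S using Finset.induction_on_max with
  | empty => simp
  | insert a S hmax ih =>
    have ha : a ∉ S := fun h => lt_irrefl _ (hmax a h)
    rw [Finset.sum_insert ha, Finset.sum_insert ha]
    have f1 : (insert a S).filter (fun d => d < a) = S := by
      ext d
      simp only [Finset.mem_filter, Finset.mem_insert]
      constructor
      · rintro ⟨rfl | h, h2⟩
        · exact absurd h2 (lt_irrefl _)
        · exact h
      · exact fun h => ⟨Or.inr h, hmax d h⟩
    have f2 : (insert a S).filter (fun d => a < d) = ∅ := by
      ext d
      simp only [Finset.mem_filter, Finset.mem_insert, Finset.notMem_empty, iff_false, not_and]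
      rintro (rfl | h)
      · exact lt_irrefl _
      · exact (hmax d h).le.not_gt
    have f3 : ∀ c ∈ S, (s c : RatFunc ℚ) * v ^ ((∑ d ∈ insert a S with d < c, s d) -
        ∑ d ∈ insert a S with c < d, s d) = ((s c : RatFunc ℚ) *
          v ^ ((∑ d ∈ S with d < c, s d) - ∑ d ∈ S with c < d, s d)) * v ^ (-s a) := by
      intro c hc
      have g1 : (insert a S).filter (fun d => d < c) = S.filter (fun d => d < c) := by
        rw [Finset.filter_insert, if_neg (hmax c hc).le.not_gt]
      have g2 : (insert a S).filter (fun d => c < d) = insert a (S.filter (fun d => c < d)) := by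
        rw [Finset.filter_insert, if_pos (hmax c hc)]
      rw [g1, g2, Finset.sum_insert (fun h => ha (Finset.mem_filter.1 h).1), mul_assoc,
        ← zpow_add₀ v_ne_zero]
      congr 2
      ring
    rw [Finset.sum_congr rfl f3, ← Finset.sum_mul, f1, f2, Finset.sum_empty, sub_zero]
    set N := ∑ c ∈ S, s c
    have key : (s a : RatFunc ℚ) * (v - v⁻¹) = v ^ (s a) - v ^ (-s a) := by
      rcases hs a with h | h | h <;> simp [h]
    have e1 : v ^ (s a + N) = v ^ s a * v ^ N := zpow_add₀ v_ne_zero _ _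
    have e2 : v ^ (-(s a + N)) = v ^ (-s a) * v ^ (-N) := by
      rw [neg_add, zpow_add₀ v_ne_zero]
    rw [e1, e2]
    linear_combination (v ^ N) * key + v ^ (-s a) * ih

lemma finite_A (ℓ : ℕ) (i : ZMod ℓ) (μ : YoungDiagram) : (A ℓ i μ).Finite :=
  (finite_addable μ).subset fun _ h => h.1

lemma finite_R (ℓ : ℕ) (i : ZMod ℓ) (μ : YoungDiagram) : (R ℓ i μ).Finite :=
  (finite_removable μ).subset fun _ h => h.1

/-- Addable boxes of color `i` as a finset. -/
noncomputable def fA (ℓ : ℕ) (i : ZMod ℓ) (μ : YoungDiagram) : Finset (ℕ × ℕ) :=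
  (finite_A ℓ i μ).toFinset

/-- Removable boxes of color `i` as a finset. -/
noncomputable def fR (ℓ : ℕ) (i : ZMod ℓ) (μ : YoungDiagram) : Finset (ℕ × ℕ) :=
  (finite_R ℓ i μ).toFinset

lemma mem_fA {ℓ : ℕ} {i : ZMod ℓ} {μ : YoungDiagram} {b : ℕ × ℕ} :
    b ∈ fA ℓ i μ ↔ IsAddable μ b ∧ color ℓ b = i := by
  rw [fA, Set.Finite.mem_toFinset]
  exact Iff.rfl

lemma mem_fR {ℓ : ℕ} {i : ZMod ℓ} {μ : YoungDiagram} {b : ℕ × ℕ} :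
    b ∈ fR ℓ i μ ↔ IsRemovable μ b ∧ color ℓ b = i := by
  rw [fR, Set.Finite.mem_toFinset]
  exact Iff.rfl

lemma Evec_eq (ℓ : ℕ) (i : ZMod ℓ) (lam : YoungDiagram) :
    Evec ℓ i lam = ∑ b ∈ fR ℓ i lam,
      v ^ (-Nr ℓ i (erased lam b) b) • Finsupp.single (erased lam b) (1 : RatFunc ℚ) :=
  finsum_mem_eq_finite_toFinset_sum _ _

lemma Fvec_eq (ℓ : ℕ) (i : ZMod ℓ) (lam : YoungDiagram) :
    Fvec ℓ i lam = ∑ b ∈ fA ℓ i lam,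
      v ^ (Nl ℓ i lam b) • Finsupp.single (added lam b) (1 : RatFunc ℚ) :=
  finsum_mem_eq_finite_toFinset_sum _ _

lemma Dc_values (μ : YoungDiagram) (c : ℤ) : -Dc μ c = -1 ∨ -Dc μ c = 0 ∨ -Dc μ c = 1 := by
  unfold Dc
  split_ifs <;> simp

/-- The coefficient of the diagonal term. -/
lemma diagonal_coeff (ℓ : ℕ) (i : ZMod ℓ) (μ : YoungDiagram) :
    ((∑ b ∈ fA ℓ i μ, v ^ (Nl ℓ i μ b - Nr ℓ i μ b))
      - ∑ b ∈ fR ℓ i μ, v ^ (Nl ℓ i μ b - Nr ℓ i μ b)) =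
      (v - v⁻¹)⁻¹ * (v ^ Nc ℓ i μ - v ^ (-Nc ℓ i μ)) := by
  set T : Finset ℤ := (fA ℓ i μ).image content ∪ (fR ℓ i μ).image content with hT
  have hcol : ∀ c ∈ T, (c : ZMod ℓ) = i := by
    intro c hc
    simp only [hT, Finset.mem_union, Finset.mem_image] at hc
    rcases hc with ⟨b, hb, rfl⟩ | ⟨b, hb, rfl⟩
    · exact (mem_fA.1 hb).2
    · exact (mem_fR.1 hb).2
  have hA : ∀ c : ℤ, (c : ZMod ℓ) = i →
      ((∃ b, IsAddable μ b ∧ content b = c) ↔ c ∈ (fA ℓ i μ).image content) := by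
    intro c hc
    simp only [Finset.mem_image, mem_fA]
    constructor
    · rintro ⟨b, hb, rfl⟩
      exact ⟨b, ⟨hb, hc⟩, rfl⟩
    · rintro ⟨b, hb, rfl⟩
      exact ⟨b, hb.1, rfl⟩
  have hR : ∀ c : ℤ, (c : ZMod ℓ) = i →
      ((∃ b, IsRemovable μ b ∧ content b = c) ↔ c ∈ (fR ℓ i μ).image content) := by
    intro c hc
    simp only [Finset.mem_image, mem_fR]
    constructor
    · rintro ⟨b, hb, rfl⟩
      exact ⟨b, ⟨hb, hc⟩, rfl⟩
    · rintro ⟨b, hb, rfl⟩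
      exact ⟨b, hb.1, rfl⟩
  have hD : ∀ c : ℤ, (c : ZMod ℓ) = i → Dc μ c =
      (if c ∈ (fR ℓ i μ).image content then 1 else 0) -
        (if c ∈ (fA ℓ i μ).image content then 1 else 0) := by
    intro c hc
    rw [Dc, if_congr (hA c hc) rfl rfl, if_congr (hR c hc) rfl rfl]
  have hsum : ∀ (P : ℤ → Prop) [DecidablePred P], Dsum μ (fun c => (c : ZMod ℓ) = i ∧ P c) =
      ∑ c ∈ T with P c, Dc μ c := by
    intro P _
    have hsup : (Function.support fun c : ℤ =>
        if (c : ZMod ℓ) = i ∧ P c then Dc μ c else 0) ⊆ (T : Set ℤ) := by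
      intro c hc
      by_contra hcT
      apply hc
      by_cases h : (c : ZMod ℓ) = i ∧ P c
      · have hcT' : c ∉ T := hcT
        simp only [hT, Finset.mem_union, not_or] at hcT'
        simp only [h, and_self, if_true]
        rw [hD c h.1, if_neg hcT'.1, if_neg hcT'.2, sub_zero]
      · exact if_neg h
    have hfs : Dsum μ (fun c => (c : ZMod ℓ) = i ∧ P c) =
        ∑ᶠ c : ℤ, if (c : ZMod ℓ) = i ∧ P c then Dc μ c else 0 := by
      unfold Dsum
      apply finsum_congr
      intro c
      congr
    rw [hfs, finsum_eq_sum_of_support_subset _ hsup, Finset.sum_filter]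
    refine Finset.sum_congr rfl fun c hc => ?_
    simp only [hcol c hc, true_and]
  have hNc : Nc ℓ i μ = ∑ c ∈ T, -Dc μ c := by
    have := hsum (fun _ => True)
    simp only [and_true, Finset.filter_true] at this
    rw [Nc_eq, this, Finset.sum_neg_distrib]
  set w : ℤ → RatFunc ℚ := fun c =>
    v ^ ((∑ d ∈ T with d < c, -Dc μ d) - ∑ d ∈ T with c < d, -Dc μ d) with hw
  have hexp : ∀ b, v ^ (Nl ℓ i μ b - Nr ℓ i μ b) = w (content b) := by
    intro b
    rw [Nl_eq, Nr_eq, hsum (fun c => content b < c), hsum (fun c => c < content b), hw]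
    simp only [Finset.sum_neg_distrib]
    congr 1
    ring
  have hsA : ∑ b ∈ fA ℓ i μ, v ^ (Nl ℓ i μ b - Nr ℓ i μ b) =
      ∑ c ∈ T, if c ∈ (fA ℓ i μ).image content then w c else 0 := by
    rw [Finset.sum_congr rfl fun b _ => hexp b, ← Finset.sum_filter,
      ← Finset.sum_image (f := w) (g := content) (s := fA ℓ i μ)]
    · refine Finset.sum_congr ?_ fun _ _ => rfl
      ext c
      simp only [hT, Finset.mem_filter, Finset.mem_union]
      tauto
    · intro x hx y hy hxy
      exact content_injOn_addable μ (mem_fA.1 hx).1 (mem_fA.1 hy).1 hxy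
  have hsR : ∑ b ∈ fR ℓ i μ, v ^ (Nl ℓ i μ b - Nr ℓ i μ b) =
      ∑ c ∈ T, if c ∈ (fR ℓ i μ).image content then w c else 0 := by
    rw [Finset.sum_congr rfl fun b _ => hexp b, ← Finset.sum_filter,
      ← Finset.sum_image (f := w) (g := content) (s := fR ℓ i μ)]
    · refine Finset.sum_congr ?_ fun _ _ => rfl
      ext c
      simp only [hT, Finset.mem_filter, Finset.mem_union]
      tauto
    · intro x hx y hy hxy
      exact content_injOn_removable μ (mem_fR.1 hx).1 (mem_fR.1 hy).1 hxy
  have htel := telescope (fun c => -Dc μ c) (Dc_values μ) T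
  rw [hNc, ← htel, mul_comm, mul_assoc, mul_inv_cancel₀ v_sub_ne_zero, mul_one, hsA, hsR,
    ← Finset.sum_sub_distrib]
  refine Finset.sum_congr rfl fun c hc => ?_
  rw [hD c (hcol c hc)]
  change _ = _ * w c
  split_ifs <;> simp

/-- Swapping the off-diagonal terms. -/
lemma off_diagonal (ℓ : ℕ) (i j : ZMod ℓ) (lam : YoungDiagram) :
    (∑ b ∈ fA ℓ j lam, ∑ b' ∈ (fR ℓ i (added lam b)).erase b,
      v ^ (Nl ℓ j lam b) • v ^ (-Nr ℓ i (erased (added lam b) b') b') •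
        Finsupp.single (erased (added lam b) b') (1 : RatFunc ℚ)) =
    ∑ b' ∈ fR ℓ i lam, ∑ b ∈ (fA ℓ j (erased lam b')).erase b',
      v ^ (-Nr ℓ i (erased lam b') b') • v ^ (Nl ℓ j (erased lam b') b) •
        Finsupp.single (added (erased lam b') b) (1 : RatFunc ℚ) := by
  rw [Finset.sum_comm' (s' := fun b' => (fA ℓ j (erased lam b')).erase b') (t' := fR ℓ i lam)]
  · refine Finset.sum_congr rfl fun b' hb' => Finset.sum_congr rfl fun b hb => ?_
    obtain ⟨hr, hi⟩ := mem_fR.1 hb'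
    obtain ⟨hne, hb⟩ := Finset.mem_erase.1 hb
    obtain ⟨ha, hj⟩ := mem_fA.1 hb
    obtain ⟨h1, h2⟩ := (swap_iff lam b b' hne.symm).2 ⟨hr, ha⟩
    rw [swap_eq hne.symm h1 h2, smul_smul, smul_smul, ← zpow_add₀ v_ne_zero,
      ← zpow_add₀ v_ne_zero]
    have := exponent_swap ℓ ha (addable_erased hr)
    rw [added_erased hr, hi, hj] at this
    congr 2
    omega
  · intro b b'
    simp only [Finset.mem_erase, mem_fA, mem_fR]
    constructor
    · rintro ⟨⟨h1, h2⟩, hne, h3, h4⟩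
      have := (swap_iff lam b b' hne).1 ⟨h1, h3⟩
      exact ⟨⟨hne.symm, this.2, h2⟩, this.1, h4⟩
    · rintro ⟨⟨hne, h1, h2⟩, h3, h4⟩
      have := (swap_iff lam b b' hne.symm).2 ⟨h3, h1⟩
      exact ⟨⟨this.1, h2⟩, hne.symm, this.2, h4⟩

lemma Eop_single (ℓ : ℕ) (i : ZMod ℓ) (lam : YoungDiagram) :
    Eop ℓ i (Finsupp.single lam 1) = Evec ℓ i lam := by
  simp [Eop]

lemma Fop_single (ℓ : ℕ) (i : ZMod ℓ) (lam : YoungDiagram) :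
    Fop ℓ i (Finsupp.single lam 1) = Fvec ℓ i lam := by
  simp [Fop]

lemma EF_single (ℓ : ℕ) (i j : ZMod ℓ) (lam : YoungDiagram) :
    Eop ℓ i (Fop ℓ j (Finsupp.single lam 1)) =
      (∑ b ∈ fA ℓ j lam, ∑ b' ∈ (fR ℓ i (added lam b)).erase b,
        v ^ (Nl ℓ j lam b) • v ^ (-Nr ℓ i (erased (added lam b) b') b') •
          Finsupp.single (erased (added lam b) b') (1 : RatFunc ℚ)) +
      if i = j then (∑ b ∈ fA ℓ i lam, v ^ (Nl ℓ i lam b - Nr ℓ i lam b)) •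
        Finsupp.single lam (1 : RatFunc ℚ) else 0 := by
  rw [Fop_single, Fvec_eq, map_sum]
  simp only [map_smul, Eop_single, Evec_eq, Finset.smul_sum]
  split_ifs with hij
  · subst hij
    rw [Finset.sum_smul, ← Finset.sum_add_distrib]
    refine Finset.sum_congr rfl fun b hb => ?_
    obtain ⟨ha, hc⟩ := mem_fA.1 hb
    rw [← Finset.sum_erase_add _ _ (mem_fR.2 ⟨removable_added ha, hc⟩), erased_added ha,
      smul_smul, ← zpow_add₀ v_ne_zero, sub_eq_add_neg]
  · rw [add_zero]
    refine Finset.sum_congr rfl fun b hb => ?_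
    rw [Finset.erase_eq_of_notMem]
    intro h
    exact hij ((mem_fR.1 h).2.symm.trans (mem_fA.1 hb).2)

lemma FE_single (ℓ : ℕ) (hℓ : 2 ≤ ℓ) (i j : ZMod ℓ) (lam : YoungDiagram) :
    Fop ℓ j (Eop ℓ i (Finsupp.single lam 1)) =
      (∑ b' ∈ fR ℓ i lam, ∑ b ∈ (fA ℓ j (erased lam b')).erase b',
        v ^ (-Nr ℓ i (erased lam b') b') • v ^ (Nl ℓ j (erased lam b') b) •
          Finsupp.single (added (erased lam b') b) (1 : RatFunc ℚ)) +
      if i = j then (∑ b ∈ fR ℓ i lam, v ^ (Nl ℓ i lam b - Nr ℓ i lam b)) •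
        Finsupp.single lam (1 : RatFunc ℚ) else 0 := by
  rw [Eop_single, Evec_eq, map_sum]
  simp only [map_smul, Fop_single, Fvec_eq, Finset.smul_sum]
  split_ifs with hij
  · subst hij
    rw [Finset.sum_smul, ← Finset.sum_add_distrib]
    refine Finset.sum_congr rfl fun b hb => ?_
    obtain ⟨hr, hc⟩ := mem_fR.1 hb
    have h1 := Nl_added_self hℓ (addable_erased hr)
    have h2 := Nr_added_self hℓ (addable_erased hr)
    rw [added_erased hr, hc] at h1 h2
    rw [← Finset.sum_erase_add _ _ (mem_fA.2 ⟨addable_erased hr, hc⟩), added_erased hr,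
      smul_smul, ← zpow_add₀ v_ne_zero, h1, h2, sub_eq_add_neg, add_comm (-_)]
  · rw [add_zero]
    refine Finset.sum_congr rfl fun b hb => ?_
    rw [Finset.erase_eq_of_notMem]
    intro h
    exact hij ((mem_fR.1 hb).2.symm.trans (mem_fA.1 h).2)

theorem stmt0 (ℓ : ℕ) (hℓ : 2 ≤ ℓ) (i j : ZMod ℓ) :
    Eop ℓ i ∘ₗ Fop ℓ j - Fop ℓ j ∘ₗ Eop ℓ i
      = (if i = j then (1 : RatFunc ℚ) else 0) • ((v - v⁻¹)⁻¹ • (Kop ℓ i - Kinvop ℓ i)) := by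
  refine Finsupp.lhom_ext' fun lam => LinearMap.ext_ring ?_
  simp only [LinearMap.comp_apply, LinearMap.sub_apply, LinearMap.smul_apply,
    Finsupp.lsingle_apply]
  rw [EF_single, FE_single ℓ hℓ, off_diagonal, add_sub_add_left_eq_sub]
  have hK : Kop ℓ i (Finsupp.single lam 1) =
      v ^ Nc ℓ i lam • Finsupp.single lam (1 : RatFunc ℚ) := by simp [Kop]
  have hK' : Kinvop ℓ i (Finsupp.single lam 1) =
      v ^ (-Nc ℓ i lam) • Finsupp.single lam (1 : RatFunc ℚ) := by simp [Kinvop]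
  rw [hK, hK']
  split_ifs with hij
  · rw [← sub_smul, ← sub_smul, diagonal_coeff, one_smul, smul_smul]
  · rw [sub_zero, zero_smul]

end MisraMiwa
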